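/- Let θ ∈ ℝ, β > 0, fix an integer M > β, and let m be an integer with m > β. Let ψ : ℝ → ℂ be m times continuously differentiable with ψ, ψ', …, ψ^{(m)} bounded, with support contained in [-2,2], and ψ not identically zero. Then there are constants c, C > 0 such that for every n ∈ ℤ: c · 2^{nθ} ≤ ‖ t ↦ 2^{θ t} ψ(t − n) ‖_{ℬ^β_{∞,∞}} ≤ C · 2^{nθ}. -/

import Mathlib

open MeasureTheory Filter Topology
open scoped ENNReal NNReal

noncomputable section

/-- Iterated difference `Δ_h^M g (x) = ∑_{j=0}^M (-1)^{M-j} (M choose j) g(x + j h)`. -/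
def iterDiff (M : ℕ) (h : ℝ) (g : ℝ → ℂ) (x : ℝ) : ℂ :=
  ∑ j ∈ Finset.range (M + 1), (-1 : ℂ) ^ (M - j) * (M.choose j : ℂ) * g (x + j * h)

/-- The Besov `ℬ^β_{∞,∞}` norm (with difference parameter `M`). -/
def besovII (β : ℝ) (M : ℕ) (g : ℝ → ℂ) : ℝ≥0∞ :=
  (⨆ x : ℝ, (‖g x‖₊ : ℝ≥0∞)) +
    ⨆ (x : ℝ) (h : ℝ) (_ : h ≠ 0),
      ENNReal.ofReal (|h| ^ (-β)) * (‖iterDiff M h g x‖₊ : ℝ≥0∞)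

/-- The Besov `ℬ^α_{∞,1}` norm (with difference parameter `M`). -/
def besovI1 (α : ℝ) (M : ℕ) (g : ℝ → ℂ) : ℝ≥0∞ :=
  (⨆ x : ℝ, (‖g x‖₊ : ℝ≥0∞)) +
    ∫⁻ h in Set.Ioo (-1 : ℝ) 1,
      ENNReal.ofReal (|h| ^ (-α - 1)) * ⨆ x : ℝ, (‖iterDiff M h g x‖₊ : ℝ≥0∞)

/-- The Mihlin class norm `‖f‖_{M^α} = ‖f ∘ exp‖_{ℬ^α_{∞,1}}`. -/
def mihlin (α : ℝ) (M : ℕ) (f : ℝ → ℂ) : ℝ≥0∞ :=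
  besovI1 α M fun s => f (Real.exp s)

/-- A homogeneous dyadic partition of unity on `(0,∞)`. -/
structure DyadicPartition where
  φ : ℝ → ℝ
  smooth : ContDiff ℝ (⊤ : ℕ∞) φ
  mem_Icc : ∀ t, φ t ∈ Set.Icc (0 : ℝ) 1
  suppSub : ∀ t, φ t ≠ 0 → t ∈ Set.Icc (1 / 2 : ℝ) 2
  sum_one : ∀ t : ℝ, 0 < t → HasSum (fun n : ℤ => φ ((2 : ℝ) ^ (-n) * t)) 1

/-- `φ̇_n(t) = φ̇_0(2^{-n} t)`, as a complex-valued function. -/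
def DyadicPartition.fn (P : DyadicPartition) (n : ℤ) : ℝ → ℂ :=
  fun t => (P.φ ((2 : ℝ) ^ (-n) * t) : ℂ)

/-- The `M^α_1` norm `∑_{n∈ℤ} ‖f ⬝ φ̇_n‖_{M^α}`. -/
def mihlinOne (α : ℝ) (M : ℕ) (P : DyadicPartition) (f : ℝ → ℂ) : ℝ≥0∞ :=
  ∑' n : ℤ, mihlin α M fun t => f t * P.fn n t

/-- A bounded `M^α` calculus on a complex Banach space `X`. -/
structure MihlinCalculus (α : ℝ) (M : ℕ) (X : Type*) [NormedAddCommGroup X]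
    [NormedSpace ℂ X] where
  Φ : (ℝ → ℂ) → X →L[ℂ] X
  C : ℝ
  C_pos : 0 < C
  norm_bound : ∀ f, (‖Φ f‖₊ : ℝ≥0∞) ≤ ENNReal.ofReal C * mihlin α M f
  map_add : ∀ f g, mihlin α M f ≠ ⊤ → mihlin α M g ≠ ⊤ →
    Φ (fun t => f t + g t) = Φ f + Φ g
  map_smul : ∀ (c : ℂ) f, mihlin α M f ≠ ⊤ → Φ (fun t => c * f t) = c • Φ f
  map_mul : ∀ f g, mihlin α M f ≠ ⊤ → mihlin α M g ≠ ⊤ →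
    Φ (fun t => f t * g t) = Φ f * Φ g

/-- The Paley–Littlewood convergence property for a dyadic partition. -/
def PaleyLittlewoodProperty {α : ℝ} {M : ℕ} {X : Type*} [NormedAddCommGroup X]
    [NormedSpace ℂ X] (T : MihlinCalculus α M X) (P : DyadicPartition) : Prop :=
  ∀ x : X, Tendsto (fun N : ℕ => ∑ n ∈ Finset.Icc (-(N : ℤ)) (N : ℤ), T.Φ (P.fn n) x)
    atTop (𝓝 x)

/-- `iterDiff` is the iterate of Mathlib's forward difference operator. -/
lemma iterDiff_eq_fwdDiff_iterate (M : ℕ) (h : ℝ) (g : ℝ → ℂ) :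
    iterDiff M h g = (fwdDiff h)^[M] g := by
  funext x
  rw [fwdDiff_iter_eq_sum_shift]
  simp [iterDiff, zsmul_eq_mul]

lemma norm_fwdDiff_iterate_le_two_pow_mul {h B : ℝ} (k : ℕ) :
    ∀ {f : ℝ → ℂ}, (∀ x, ‖f x‖ ≤ B) → ∀ x, ‖(fwdDiff h)^[k] f x‖ ≤ 2 ^ k * B := by
  induction k with
  | zero => intro f hf x; simpa using hf x
  | succ k ih =>
    intro f hf x
    rw [Function.iterate_succ_apply', fwdDiff]
    calc _ ≤ ‖(fwdDiff h)^[k] f (x + h)‖ + ‖(fwdDiff h)^[k] f x‖ := norm_sub_le _ _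
      _ ≤ 2 ^ k * B + 2 ^ k * B := add_le_add (ih hf _) (ih hf _)
      _ = 2 ^ (k + 1) * B := by ring

lemma norm_fwdDiff_iterate_le_abs_pow_mul {h : ℝ} (k : ℕ) :
    ∀ {f : ℝ → ℂ} {B : ℝ}, ContDiff ℝ k f → (∀ x, ‖iteratedDeriv k f x‖ ≤ B) →
      ∀ x, ‖(fwdDiff h)^[k] f x‖ ≤ |h| ^ k * B := by
  induction k with
  | zero => intro f B _ hB x; simpa using hB x
  | succ k ih =>
    intro f B hf hB x
    have hfk : ContDiff ℝ k f := hf.of_le (by exact_mod_cast Nat.le_succ k)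
    have hshift : ContDiff ℝ k fun y => f (y + h) :=
      hfk.comp (contDiff_id.add contDiff_const)
    have hbound : ∀ y, ‖iteratedDeriv k (fwdDiff h f) y‖ ≤ |h| * B := by
      intro y
      have hdiff : Differentiable ℝ (iteratedDeriv k f) :=
        hf.differentiable_iteratedDeriv k (by exact_mod_cast Nat.lt_succ_self k)
      have heq : iteratedDeriv k (fwdDiff h f) y
          = iteratedDeriv k f (y + h) - iteratedDeriv k f y := by
        have : fwdDiff h f = (fun y => f (y + h)) - f := rfl
        rw [this, iteratedDeriv_sub hshift.contDiffAt hfk.contDiffAt,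
          iteratedDeriv_comp_add_const]
      have hmv := Convex.norm_image_sub_le_of_norm_deriv_le (s := Set.univ) (C := B)
        (f := iteratedDeriv k f) (x := y) (y := y + h) (fun z _ => hdiff z)
        (fun z _ => by rw [← iteratedDeriv_succ]; exact hB z) convex_univ trivial trivial
      rw [heq]
      simpa [mul_comm] using hmv
    rw [Function.iterate_succ_apply]
    calc _ ≤ |h| ^ k * (|h| * B) := ih (hshift.sub hfk) hbound x
      _ = |h| ^ (k + 1) * B := by ring

/-- A bounded function whose `k`-th derivative is bounded, `β < k ≤ M`, has bounded
`β`-weighted differences of order `M`. -/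
lemma rpow_mul_norm_iterDiff_le {β A B : ℝ} (hβ : 0 < β) {k M : ℕ} (hk : β < k) (hkM : k ≤ M)
    {g : ℝ → ℂ} (hg : ContDiff ℝ k g) (hA : ∀ x, ‖g x‖ ≤ A)
    (hB : ∀ x, ‖iteratedDeriv k g x‖ ≤ B) (x : ℝ) {h : ℝ} (hh : h ≠ 0) :
    |h| ^ (-β) * ‖iterDiff M h g x‖ ≤ 2 ^ M * A + 2 ^ (M - k) * B := by
  have hA0 : 0 ≤ A := (norm_nonneg _).trans (hA 0)
  have hB0 : 0 ≤ B := (norm_nonneg _).trans (hB 0)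
  have hpos : 0 < |h| := abs_pos.2 hh
  rw [iterDiff_eq_fwdDiff_iterate]
  rcases le_total 1 |h| with h1 | h1
  · have hw : |h| ^ (-β) ≤ 1 := Real.rpow_le_one_of_one_le_of_nonpos h1 (by linarith)
    calc _ ≤ 1 * (2 ^ M * A) :=
          mul_le_mul hw (norm_fwdDiff_iterate_le_two_pow_mul M hA x) (norm_nonneg _) zero_le_one
      _ ≤ _ := by rw [one_mul]; exact le_add_of_nonneg_right (by positivity)
  · have hle : ‖(fwdDiff h)^[M] g x‖ ≤ 2 ^ (M - k) * (|h| ^ k * B) := by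
      rw [← Nat.sub_add_cancel hkM, Function.iterate_add_apply, Nat.add_sub_cancel]
      exact norm_fwdDiff_iterate_le_two_pow_mul _ (norm_fwdDiff_iterate_le_abs_pow_mul k hg hB) x
    have hw : |h| ^ (-β) * |h| ^ k ≤ 1 := by
      rw [← Real.rpow_natCast, ← Real.rpow_add hpos]
      exact Real.rpow_le_one hpos.le h1 (by linarith)
    calc _ ≤ |h| ^ (-β) * (2 ^ (M - k) * (|h| ^ k * B)) := by gcongr
      _ = |h| ^ (-β) * |h| ^ k * (2 ^ (M - k) * B) := by ring
      _ ≤ 1 * (2 ^ (M - k) * B) := by gcongr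
      _ ≤ _ := by rw [one_mul]; exact le_add_of_nonneg_left (by positivity)

lemma iterDiff_const_mul_comp_sub (M : ℕ) (h : ℝ) (c : ℂ) (g : ℝ → ℂ) (a x : ℝ) :
    iterDiff M h (fun t => c * g (t - a)) x = c * iterDiff M h g (x - a) := by
  simp only [iterDiff, Finset.mul_sum]
  refine Finset.sum_congr rfl fun j _ => ?_
  rw [show x + j * h - a = x - a + j * h by ring]
  ring

lemma two_rpow_mul_mul_comp_sub (θ a : ℝ) (ψ : ℝ → ℂ) :
    (fun t : ℝ => (((2 : ℝ) ^ (θ * t) : ℝ) : ℂ) * ψ (t - a)) =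
      fun t => (((2 : ℝ) ^ (a * θ) : ℝ) : ℂ) *
        (fun s : ℝ => (((2 : ℝ) ^ (θ * s) : ℝ) : ℂ) * ψ s) (t - a) := by
  funext t
  rw [← mul_assoc, ← Complex.ofReal_mul, ← Real.rpow_add two_pos]
  ring_nf

lemma exists_norm_iteratedDeriv_le {f : ℝ → ℂ} {k : ℕ} (hf : ContDiff ℝ k f)
    (hc : HasCompactSupport f) : ∃ B, ∀ x, ‖iteratedDeriv k f x‖ ≤ B := by
  obtain ⟨B, hB⟩ := (hc.iteratedFDeriv (𝕜 := ℝ) k).exists_bound_of_continuous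
    (hf.continuous_iteratedFDeriv le_rfl)
  exact ⟨B, fun x => norm_iteratedFDeriv_eq_norm_iteratedDeriv (𝕜 := ℝ) (f := f) ▸ hB x⟩

/-- two-sided bound `‖2^{θt} ψ(t-n)‖_{ℬ^β_{∞,∞}} ≍ 2^{nθ}`. -/
theorem stmt_12 (θ β : ℝ) (hβ : 0 < β) (M : ℕ) (hM : β < (M : ℝ))
    (m : ℕ) (hm : β < (m : ℝ)) (ψ : ℝ → ℂ)
    (hsm : ContDiff ℝ (m : ℕ∞) ψ)
    (hbd : ∀ k ≤ m, ∃ B : ℝ, ∀ x, ‖iteratedDeriv k ψ x‖ ≤ B)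
    (hsupp : ∀ x : ℝ, ψ x ≠ 0 → x ∈ Set.Icc (-2 : ℝ) 2)
    (hne : ∃ x, ψ x ≠ 0) :
    ∃ c C : ℝ, 0 < c ∧ 0 < C ∧ ∀ n : ℤ,
      ENNReal.ofReal (c * (2 : ℝ) ^ ((n : ℝ) * θ)) ≤
        besovII β M (fun t => (((2 : ℝ) ^ (θ * t) : ℝ) : ℂ) * ψ (t - n)) ∧
      besovII β M (fun t => (((2 : ℝ) ^ (θ * t) : ℝ) : ℂ) * ψ (t - n)) ≤
        ENNReal.ofReal (C * (2 : ℝ) ^ ((n : ℝ) * θ)) := by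
  set G : ℝ → ℂ := fun s => (((2 : ℝ) ^ (θ * s) : ℝ) : ℂ) * ψ s with hG
  have hGsm : ContDiff ℝ m G := by
    have hexp : ContDiff ℝ m fun s : ℝ => (2 : ℝ) ^ (θ * s) :=
      contDiff_const.rpow (contDiff_const.mul contDiff_id) fun _ => two_ne_zero
    exact (Complex.ofRealCLM.contDiff.comp hexp).mul hsm
  have hGc : HasCompactSupport G := by
    refine HasCompactSupport.intro (isCompact_Icc (a := (-2 : ℝ)) (b := 2)) fun x hx => ?_
    have : ψ x = 0 := by_contra fun h => hx (hsupp x h)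
    simp [hG, this]
  have hk : β < (min M m : ℕ) := by rw [Nat.cast_min]; exact lt_min hM hm
  have hGk : ContDiff ℝ (min M m : ℕ) G := hGsm.of_le (by exact_mod_cast min_le_right M m)
  obtain ⟨A, hA⟩ := hGc.exists_bound_of_continuous hGsm.continuous
  obtain ⟨B, hB⟩ := exists_norm_iteratedDeriv_le hGk hGc
  obtain ⟨x₀, hx₀⟩ := hne
  have hGx₀ : 0 < ‖G x₀‖ :=
    norm_pos_iff.2 <| mul_ne_zero (Complex.ofReal_ne_zero.2 (by positivity)) hx₀
  have hA0 : 0 < A := hGx₀.trans_le (hA x₀)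
  have hB0 : 0 ≤ B := (norm_nonneg _).trans (hB 0)
  refine ⟨‖G x₀‖, A + (2 ^ M * A + 2 ^ (M - min M m) * B), hGx₀, by positivity, fun n => ?_⟩
  have hscale : (fun t : ℝ => (((2 : ℝ) ^ (θ * t) : ℝ) : ℂ) * ψ (t - n)) =
      fun t => (((2 : ℝ) ^ ((n : ℝ) * θ) : ℝ) : ℂ) * G (t - n) :=
    two_rpow_mul_mul_comp_sub θ n ψ
  rw [hscale]
  clear_value G
  have hw : 0 < (2 : ℝ) ^ ((n : ℝ) * θ) := by positivity
  have hwn : ‖(((2 : ℝ) ^ ((n : ℝ) * θ) : ℝ) : ℂ)‖ = (2 : ℝ) ^ ((n : ℝ) * θ) := by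
    rw [Complex.norm_real, Real.norm_of_nonneg hw.le]
  simp only [besovII, iterDiff_const_mul_comp_sub, ← enorm_eq_nnnorm, ← ofReal_norm, norm_mul, hwn]
  constructor
  · refine le_add_right (le_iSup_of_le (x₀ + n) ?_)
    rw [add_sub_cancel_right, mul_comm]
  · rw [add_mul, ENNReal.ofReal_add (by positivity) (by positivity)]
    refine add_le_add (iSup_le fun x => ENNReal.ofReal_le_ofReal ?_)
      (iSup_le fun x => iSup_le fun h => iSup_le fun hh => ?_)
    · rw [mul_comm]
      gcongr
      exact hA _
    · rw [← ENNReal.ofReal_mul (by positivity)]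
      refine ENNReal.ofReal_le_ofReal ?_
      rw [mul_left_comm, mul_comm]
      gcongr
      exact rpow_mul_norm_iterDiff_le hβ hk (min_le_left M m) hGk hA hB _ hh
end
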